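/- arXiv:2102.09438 — 2 statements merged into one kernel-verified Lean document; each statement's English description precedes it below -/
import Mathlib

section
/- Let a, b > 0 and r = ab/(a + b). Let E = {(x,y) ∈ ℝ² : x²/a² + y²/b² = 1} and let C_r be the circle of radius r centered at the origin. Then for every triangle with vertices on E that circumscribes C_r (so that C_r is its incircle and the origin its incenter), the power of the origin with respect to the circumcircle equals −ab, and the power of the origin with respect to the nine-point circle equals −ab·(a² + b²)/(2(a + b)²). -/
open scoped RealInnerProductSpace

noncomputable section

/-- Points of the Euclidean plane. -/
abbrev Pt := EuclideanSpace ℝ (Fin 2)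

/-- The sideline through two points `A`, `B`. -/
def sideline (A B : Pt) : Set Pt := {X | ∃ t : ℝ, X = A + t • (B - A)}

/-- A line `L` is tangent to a conic `C` if it meets `C` in exactly one point. -/
def IsTangentLine (L C : Set Pt) : Prop := ∃! Q, Q ∈ L ∩ C

/-- A triangle `P₁P₂P₃` circumscribes `C` when each sideline is tangent to `C`
and `C` is contained in the convex hull of the vertices. -/
def Circumscribes (P₁ P₂ P₃ : Pt) (C : Set Pt) : Prop :=
  IsTangentLine (sideline P₁ P₂) C ∧ IsTangentLine (sideline P₂ P₃) C ∧
  IsTangentLine (sideline P₃ P₁) C ∧ C ⊆ convexHull ℝ {P₁, P₂, P₃}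

/-- The power of a point `X` with respect to the circle with center `C` and radius `ρ`. -/
def circlePower (X C : Pt) (ρ : ℝ) : ℝ := dist X C ^ 2 - ρ ^ 2


/-- Membership in the conic `x² / a² + y² / b² = 1` of the intersection of the tangents to the
circle of radius `a * b / (a + b)` at the points with unit parameters `v` and `w`. -/
lemma tangent_pair_on_ellipse {a b r v w z z' : ℂ} (ha : a ≠ 0) (hb : b ≠ 0) (hab : a + b ≠ 0)
    (hr : r * (a + b) = a * b)
    (hp : z * (v + w) = 2 * r * (v * w)) (hs : z' * (v + w) = 2 * r)
    (hE : b ^ 2 * (z + z') ^ 2 - a ^ 2 * (z - z') ^ 2 = 4 * a ^ 2 * b ^ 2) :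
    ((b - a) / (a + b) * (v * w) + 1) * (v * w + (b - a) / (a + b)) = (v + w) ^ 2 := by
  have hr' : r = a * b / (a + b) := by field_simp; exact hr
  have h : r ^ 2 * (b ^ 2 * (v * w + 1) ^ 2 - a ^ 2 * (v * w - 1) ^ 2)
      = a ^ 2 * b ^ 2 * (v + w) ^ 2 := by
    have h4 : (4 : ℂ) ≠ 0 := by norm_num
    apply mul_left_cancel₀ h4
    linear_combination (v + w) ^ 2 * hE
      - (b ^ 2 * (z * (v + w) + z' * (v + w) + 2 * r * (v * w) + 2 * r)
          - a ^ 2 * (z * (v + w) - z' * (v + w) + 2 * r * (v * w) - 2 * r)) * hp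
      - (b ^ 2 * (z * (v + w) + z' * (v + w) + 2 * r * (v * w) + 2 * r)
          + a ^ 2 * (z * (v + w) - z' * (v + w) + 2 * r * (v * w) - 2 * r)) * hs
  rw [hr'] at h
  field_simp at h ⊢
  linear_combination h

/-- The elementary symmetric functions of the contact parameters of a Poncelet triangle. -/
lemma contact_symmetric_functions {α u v w : ℂ} (hα : 1 - α ^ 2 ≠ 0) (hu : u ≠ 0) (hvw : v ≠ w)
    (h₁ : (α * (u * v) + 1) * (u * v + α) = (u + v) ^ 2)
    (h₂ : (α * (u * w) + 1) * (u * w + α) = (u + w) ^ 2) :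
    u * v + v * w + w * u = -α ∧ u + v + w = -α * (u * v * w) := by
  have hs : (α * u ^ 2 - 1) * (v + w) = (1 - α ^ 2) * u := by
    apply mul_left_cancel₀ (sub_ne_zero.2 hvw)
    linear_combination h₁ - h₂
  have hn : α * u ^ 2 - 1 ≠ 0 := fun h0 => by
    rw [h0, zero_mul] at hs
    exact mul_ne_zero hα hu hs.symm
  have hp : (α * u ^ 2 - 1) * (v * w) = α - u ^ 2 := by
    linear_combination v * hs - h₁
  constructor
  · apply mul_left_cancel₀ hn
    linear_combination u * hs + hp
  · apply mul_left_cancel₀ hn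
    linear_combination hs + α * u * hp

/-- A quadratic polynomial with three distinct roots vanishes. -/
lemma quadratic_coeffs_eq_zero {A B C u v w : ℂ} (huv : u ≠ v) (hvw : v ≠ w) (hwu : w ≠ u)
    (h₁ : A * u ^ 2 + B * u + C = 0) (h₂ : A * v ^ 2 + B * v + C = 0)
    (h₃ : A * w ^ 2 + B * w + C = 0) : A = 0 ∧ B = 0 ∧ C = 0 := by
  have e₁ : A * (u + v) + B = 0 := by
    apply mul_left_cancel₀ (sub_ne_zero.2 huv)
    linear_combination h₁ - h₂
  have e₂ : A * (v + w) + B = 0 := by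
    apply mul_left_cancel₀ (sub_ne_zero.2 hvw)
    linear_combination h₂ - h₃
  have hA : A = 0 := by
    apply mul_left_cancel₀ (sub_ne_zero.2 hwu)
    linear_combination e₂ - e₁
  subst hA
  have hB : B = 0 := by linear_combination e₁
  subst hB
  exact ⟨rfl, rfl, by linear_combination h₁⟩

/-- The circumcircle of the triangle whose sides touch the circle of radius `r` at the points with
unit parameters `u`, `v`, `w`, when these satisfy the Poncelet relations with parameter `α`. -/
lemma circumcircle_of_contact {α r u v w z₁ z₁' z₂ z₂' z₃ z₃' o o' q : ℂ}
    (hr : r ≠ 0) (hu : u ≠ 0) (hv : v ≠ 0) (hw : w ≠ 0)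
    (huv : u ≠ v) (hvw : v ≠ w) (hwu : w ≠ u)
    (he₂ : u * v + v * w + w * u = -α) (he₁ : u + v + w = -α * (u * v * w))
    (hp₁ : z₁ * (v + w) = 2 * r * (v * w)) (hs₁ : z₁' * (v + w) = 2 * r)
    (hp₂ : z₂ * (w + u) = 2 * r * (w * u)) (hs₂ : z₂' * (w + u) = 2 * r)
    (hp₃ : z₃ * (u + v) = 2 * r * (u * v)) (hs₃ : z₃' * (u + v) = 2 * r)
    (hc₁ : z₁ * z₁' - o * z₁' - o' * z₁ = q)
    (hc₂ : z₂ * z₂' - o * z₂' - o' * z₂ = q)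
    (hc₃ : z₃ * z₃' - o * z₃' - o' * z₃ = q) :
    q * (1 - α ^ 2) = 4 * r ^ 2 ∧ o' * (u * v * w) * (1 - α ^ 2) = 2 * r * α ∧
      o * (1 - α ^ 2) = 2 * r * α * (u * v * w) ∧
      (z₁ + z₂ + z₃ - o) * (u * v * w) * (1 - α ^ 2) = -2 * r * α ^ 2 ∧
      (z₁' + z₂' + z₃' - o') * (1 - α ^ 2) = -2 * r * α ^ 2 * (u * v * w) := by
  have key : ∀ s p z z' : ℂ, z * s = 2 * r * p → z' * s = 2 * r →
      z * z' - o * z' - o' * z = q →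
      4 * r ^ 2 * p - 2 * r * s * o - 2 * r * p * s * o' - q * s ^ 2 = 0 := by
    intro s p z z' h h' hq
    linear_combination s ^ 2 * hq - (z' * s - o' * s) * h - (2 * r * p - o * s) * h'
  have k₁ := key _ _ _ _ hp₁ hs₁ hc₁
  have k₂ := key _ _ _ _ hp₂ hs₂ hc₂
  have k₃ := key _ _ _ _ hp₃ hs₃ hc₃
  obtain ⟨hA, hB, hC⟩ := quadratic_coeffs_eq_zero
    (A := 4 * r ^ 2 - 2 * r * o' * (u + v + w) - q)
    (B := -4 * r ^ 2 * (u + v + w) + 2 * r * o + 2 * r * o' * (u + v + w) ^ 2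
      + 2 * q * (u + v + w))
    (C := 4 * r ^ 2 * (u * v + v * w + w * u) - 2 * r * (u + v + w) * o
      - 2 * r * o' * (u + v + w) * (u * v + v * w + w * u) + 2 * r * o' * (u * v * w)
      - q * (u + v + w) ^ 2) huv hvw hwu
    (by linear_combination k₁) (by linear_combination k₂) (by linear_combination k₃)
  have hprod : (u + v) * (v + w) * (w + u) = (α ^ 2 - 1) * (u * v * w) := by
    linear_combination (u + v + w) * he₂ - α * he₁
  have hz : (z₁ + z₂ + z₃) * (u * v * w) * (1 - α ^ 2)
      = 2 * r * (α * (u * v * w) ^ 2 - α ^ 2) := by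
    linear_combination (z₁ + z₂ + z₃) * hprod - (u + v) * (w + u) * hp₁ - (u + v) * (v + w) * hp₂
      - (v + w) * (w + u) * hp₃
      - 2 * r * (u * v * w * he₁ + (u * v + v * w + w * u - α) * he₂)
  have hz' : (z₁' + z₂' + z₃') * (u * v * w) * (1 - α ^ 2)
      = 2 * r * (α - α ^ 2 * (u * v * w) ^ 2) := by
    linear_combination (z₁' + z₂' + z₃') * hprod - (u + v) * (w + u) * hs₁
      - (u + v) * (v + w) * hs₂ - (v + w) * (w + u) * hs₃
      - 2 * r * ((u + v + w - α * (u * v * w)) * he₁ + he₂)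
  have he : u * v * w ≠ 0 := mul_ne_zero (mul_ne_zero hu hv) hw
  rw [he₂, he₁] at hC
  rw [he₁] at hA hB
  clear he₁ he₂ k₁ k₂ k₃ hprod key
  generalize u * v * w = e at *
  have h2 : 2 * r ≠ 0 := by simpa using hr
  have ho : o = o' * α ^ 2 * e ^ 2 + 2 * r * α * e := by
    apply mul_left_cancel₀ h2
    linear_combination hB - 2 * α * e * hA
  have ho' : o' * e * (1 - α ^ 2) = 2 * r * α := by
    apply mul_left_cancel₀ h2
    linear_combination hC - 2 * r * α * e * ho - α ^ 2 * e ^ 2 * hA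
  have ho₁ : o * (1 - α ^ 2) = 2 * r * α * e := by
    linear_combination (1 - α ^ 2) * ho + α ^ 2 * e * ho'
  refine ⟨?_, ho', ho₁, ?_, ?_⟩
  · linear_combination -(1 - α ^ 2) * hA + 2 * r * α * ho'
  · linear_combination hz - e * ho₁
  · apply mul_left_cancel₀ he
    linear_combination hz' - ho'

/-- The power relations for a Poncelet triangle, in conjugate coordinates. -/
lemma poncelet_power_relations {a b r u v w z₁ z₁' z₂ z₂' z₃ z₃' o o' q : ℂ}
    (ha : a ≠ 0) (hb : b ≠ 0) (hab : a + b ≠ 0) (hr : r * (a + b) = a * b)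
    (hu : u ≠ 0) (hv : v ≠ 0) (hw : w ≠ 0)
    (huv : u ≠ v) (hvw : v ≠ w) (hwu : w ≠ u)
    (h₁v : z₁ + z₁' * v ^ 2 = 2 * r * v) (h₁w : z₁ + z₁' * w ^ 2 = 2 * r * w)
    (h₂w : z₂ + z₂' * w ^ 2 = 2 * r * w) (h₂u : z₂ + z₂' * u ^ 2 = 2 * r * u)
    (h₃u : z₃ + z₃' * u ^ 2 = 2 * r * u) (h₃v : z₃ + z₃' * v ^ 2 = 2 * r * v)
    (hE₂ : b ^ 2 * (z₂ + z₂') ^ 2 - a ^ 2 * (z₂ - z₂') ^ 2 = 4 * a ^ 2 * b ^ 2)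
    (hE₃ : b ^ 2 * (z₃ + z₃') ^ 2 - a ^ 2 * (z₃ - z₃') ^ 2 = 4 * a ^ 2 * b ^ 2)
    (hc₁ : z₁ * z₁' - o * z₁' - o' * z₁ = q)
    (hc₂ : z₂ * z₂' - o * z₂' - o' * z₂ = q)
    (hc₃ : z₃ * z₃' - o * z₃' - o' * z₃ = q) :
    q = a * b ∧ ((z₁ + z₂ + z₃ - o) * (z₁' + z₂' + z₃' - o') - (q + o * o')) * (a + b) ^ 2
      = -2 * (a * b) * (a ^ 2 + b ^ 2) := by
  have hs : ∀ {x y z z' : ℂ}, x ≠ y → z + z' * x ^ 2 = 2 * r * x → z + z' * y ^ 2 = 2 * r * y →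
      z' * (x + y) = 2 * r := by
    intro x y z z' hxy hx hy
    apply mul_left_cancel₀ (sub_ne_zero.2 hxy)
    linear_combination hx - hy
  have hp : ∀ {x y z z' : ℂ}, x ≠ y → z + z' * x ^ 2 = 2 * r * x → z + z' * y ^ 2 = 2 * r * y →
      z * (x + y) = 2 * r * (x * y) := by
    intro x y z z' hxy hx hy
    linear_combination (x + y) * hx - x ^ 2 * hs hxy hx hy
  have hr0 : r ≠ 0 := by
    rintro rfl
    exact mul_ne_zero ha hb (by rw [← hr, zero_mul])
  obtain ⟨α, hα⟩ : ∃ α, α = (b - a) / (a + b) := ⟨_, rfl⟩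
  have hα_mul : α * (a + b) = b - a := by rw [hα]; field_simp
  have hαab : (1 - α ^ 2) * (a + b) ^ 2 = 4 * (a * b) := by
    linear_combination -(α * (a + b) + b - a) * hα_mul
  have hα1 : 1 - α ^ 2 ≠ 0 := by
    intro h
    rw [h, zero_mul] at hαab
    exact mul_ne_zero ha hb (by linear_combination -hαab / 4)
  have hF₃ := tangent_pair_on_ellipse ha hb hab hr (hp huv h₃u h₃v) (hs huv h₃u h₃v) hE₃
  have hF₂ := tangent_pair_on_ellipse ha hb hab hr (hp hwu.symm h₂u h₂w) (hs hwu.symm h₂u h₂w) hE₂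
  rw [← hα] at hF₂ hF₃
  obtain ⟨he₂, he₁⟩ := contact_symmetric_functions hα1 hu hvw hF₃ hF₂
  obtain ⟨hq, ho', ho, hz, hz'⟩ := circumcircle_of_contact hr0 hu hv hw huv hvw hwu he₂ he₁
    (hp hvw h₁v h₁w) (hs hvw h₁v h₁w) (hp hwu h₂w h₂u) (hs hwu h₂w h₂u)
    (hp huv h₃u h₃v) (hs huv h₃u h₃v) hc₁ hc₂ hc₃
  have hab0 : a * b ≠ 0 := mul_ne_zero ha hb
  have hqab : q = a * b := by
    have h4 : 4 * (a * b) ≠ 0 := by simp [ha, hb]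
    apply mul_left_cancel₀ h4
    linear_combination (-q) * hαab + (a + b) ^ 2 * hq + 4 * (r * (a + b) + a * b) * hr
  refine ⟨hqab, ?_⟩
  have he : u * v * w ≠ 0 := mul_ne_zero (mul_ne_zero hu hv) hw
  generalize u * v * w = e at *
  have hoo : o * o' * (1 - α ^ 2) ^ 2 = 4 * r ^ 2 * α ^ 2 := by
    apply mul_left_cancel₀ he
    linear_combination o' * e * (1 - α ^ 2) * ho + 2 * r * α * e * ho'
  have hzz : (z₁ + z₂ + z₃ - o) * (z₁' + z₂' + z₃' - o') * (1 - α ^ 2) ^ 2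
      = 4 * r ^ 2 * α ^ 4 := by
    apply mul_left_cancel₀ he
    linear_combination (z₁' + z₂' + z₃' - o') * (1 - α ^ 2) * hz - 2 * r * α ^ 2 * hz'
  have hdiff : (z₁ + z₂ + z₃ - o) * (z₁' + z₂' + z₃' - o') - (q + o * o')
      = -q * (1 + α ^ 2) := by
    apply mul_left_cancel₀ (pow_ne_zero 2 hα1)
    linear_combination hzz - hoo + α ^ 2 * (1 - α ^ 2) * hq
  rw [hdiff, hqab]
  linear_combination -(a * b) * (α * (a + b) + b - a) * hα_mul

/-- A line tangent to the circle of radius `r` at the origin has an equation `c * x + s * y = r` with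
unit normal `(c, s)`. -/
lemma exists_unit_normal_of_isTangentLine {A B : Pt} {r : ℝ} (hr : r ≠ 0) (hAB : A ≠ B)
    (h : IsTangentLine (sideline A B) {P : Pt | (P 0) ^ 2 + (P 1) ^ 2 = r ^ 2}) :
    ∃ c s : ℝ, c ^ 2 + s ^ 2 = 1 ∧ c * A 0 + s * A 1 = r ∧ c * B 0 + s * B 1 = r := by
  obtain ⟨Q, ⟨⟨t, rfl⟩, hQ⟩, huniq⟩ := h
  set D := B - A with hD
  have hD0 : D ≠ 0 := sub_ne_zero.2 hAB.symm
  have hDsq : (D 0) ^ 2 + (D 1) ^ 2 ≠ 0 := by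
    intro h0
    apply hD0
    ext i
    fin_cases i
    · simp only [Fin.zero_eta, PiLp.zero_apply]; nlinarith [sq_nonneg (D 0), sq_nonneg (D 1)]
    · simp only [Fin.mk_one, PiLp.zero_apply]; nlinarith [sq_nonneg (D 0), sq_nonneg (D 1)]
  simp only [Set.mem_ofPred_eq, PiLp.add_apply, PiLp.smul_apply, smul_eq_mul] at hQ
  obtain ⟨k, hk⟩ : ∃ k, k * ((D 0) ^ 2 + (D 1) ^ 2)
      = (A 0 + t * D 0) * D 0 + (A 1 + t * D 1) * D 1 :=
    ⟨_, div_mul_cancel₀ _ hDsq⟩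
  have h2 := huniq (A + (t - 2 * k) • D) ⟨⟨_, rfl⟩, by
    simp only [Set.mem_ofPred_eq, PiLp.add_apply, PiLp.smul_apply, smul_eq_mul]
    linear_combination hQ + 4 * k * hk⟩
  have hk0 : k = 0 := by
    have h3 : t - 2 * k = t := smul_left_injective ℝ hD0 (add_left_cancel h2)
    linarith
  rw [hk0, zero_mul] at hk
  have hB0 : B 0 = A 0 + D 0 := by simp [hD]
  have hB1 : B 1 = A 1 + D 1 := by simp [hD]
  refine ⟨(A 0 + t * D 0) / r, (A 1 + t * D 1) / r, ?_, ?_, ?_⟩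
  · field_simp
    linear_combination hQ
  · field_simp
    linear_combination hQ + t * hk
  · rw [hB0, hB1]
    field_simp
    linear_combination hQ + (t - 1) * hk

/-- The vertices of a nondegenerate triangle in the plane span a nonzero area. -/
lemma det_ne_zero_of_affineIndependent {P₁ P₂ P₃ : Pt}
    (h : AffineIndependent ℝ ![P₁, P₂, P₃]) :
    (P₂ 0 - P₁ 0) * (P₃ 1 - P₁ 1) - (P₂ 1 - P₁ 1) * (P₃ 0 - P₁ 0) ≠ 0 := by
  intro h0
  rw [affineIndependent_iff] at h
  have key : ∀ i : Fin 2, P₁ i = P₂ i := by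
    intro i
    have := h Finset.univ ![P₂ i - P₃ i, P₃ i - P₁ i, P₁ i - P₂ i]
      (by simp [Fin.sum_univ_three])
      (by
        ext j
        fin_cases i <;> fin_cases j <;> simp [Fin.sum_univ_three] <;> linarith)
      2 (Finset.mem_univ _)
    simpa [sub_eq_zero] using this
  have h₁₂ : P₁ = P₂ := PiLp.ext key
  have := h Finset.univ ![1, -1, 0] (by simp [Fin.sum_univ_three])
    (by simp [Fin.sum_univ_three, h₁₂]) 0 (Finset.mem_univ _)
  simp at this

/-- Two sidelines of a nondegenerate triangle have different unit normals. -/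
lemma normals_ne_of_det_ne_zero {x₁ y₁ x₂ y₂ x₃ y₃ r c s c' s' : ℝ}
    (hdet : (x₂ - x₁) * (y₃ - y₁) - (y₂ - y₁) * (x₃ - x₁) ≠ 0)
    (hn : c ^ 2 + s ^ 2 = 1) (h₁ : c * x₁ + s * y₁ = r) (h₂ : c * x₂ + s * y₂ = r)
    (h₃ : c' * x₃ + s' * y₃ = r) : (⟨c, s⟩ : ℂ) ≠ ⟨c', s'⟩ := by
  intro h
  obtain ⟨rfl, rfl⟩ := Complex.mk.inj h
  apply hdet
  linear_combination (-((x₂ - x₁) * (y₃ - y₁) - (y₂ - y₁) * (x₃ - x₁))) * hn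
    + (c * (y₃ - y₁) - s * (x₃ - x₁)) * (h₂ - h₁) + (s * (x₂ - x₁) - c * (y₂ - y₁)) * (h₃ - h₁)

/-- The equation of a line with unit normal `(c, s)` in conjugate coordinates. -/
lemma conj_line_equation {x y r c s : ℝ} (hn : c ^ 2 + s ^ 2 = 1) (h : c * x + s * y = r) :
    (⟨x, y⟩ : ℂ) + ⟨x, -y⟩ * ⟨c, s⟩ ^ 2 = 2 * r * ⟨c, s⟩ := by
  apply Complex.ext
  · simp [pow_two]
    linear_combination 2 * c * h - x * hn
  · simp [pow_two]
    linear_combination 2 * s * h - y * hn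

/-- A unit vector is a nonzero complex number. -/
lemma mk_ne_zero_of_unit {c s : ℝ} (hn : c ^ 2 + s ^ 2 = 1) : (⟨c, s⟩ : ℂ) ≠ 0 := by
  intro h
  have h0 : c = 0 := congrArg Complex.re h
  have h1 : s = 0 := congrArg Complex.im h
  simp [h0, h1] at hn

/-- The equation of an ellipse in conjugate coordinates. -/
lemma conj_ellipse_equation {a b x y : ℝ} (ha : a ≠ 0) (hb : b ≠ 0)
    (h : x ^ 2 / a ^ 2 + y ^ 2 / b ^ 2 = 1) :
    (b : ℂ) ^ 2 * ((⟨x, y⟩ : ℂ) + ⟨x, -y⟩) ^ 2 - (a : ℂ) ^ 2 * ((⟨x, y⟩ : ℂ) - ⟨x, -y⟩) ^ 2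
      = 4 * (a : ℂ) ^ 2 * (b : ℂ) ^ 2 := by
  field_simp at h
  have e₁ : (⟨x, y⟩ : ℂ) + ⟨x, -y⟩ = ((2 * x : ℝ) : ℂ) := by
    apply Complex.ext <;> simp; ring
  have e₂ : ((⟨x, y⟩ : ℂ) - ⟨x, -y⟩) ^ 2 = ((-(4 * y ^ 2) : ℝ) : ℂ) := by
    apply Complex.ext <;> simp [pow_two]; ring
  rw [e₁, e₂]
  norm_cast
  linear_combination 4 * h

/-- The equation of a circle in conjugate coordinates. -/
lemma conj_circle_equation {x y p q R : ℝ} (h : (p - x) ^ 2 + (q - y) ^ 2 = R ^ 2) :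
    (⟨x, y⟩ : ℂ) * ⟨x, -y⟩ - ⟨p, q⟩ * ⟨x, -y⟩ - ⟨p, -q⟩ * ⟨x, y⟩
      = ((R ^ 2 - p ^ 2 - q ^ 2 : ℝ) : ℂ) := by
  apply Complex.ext
  · rw [Complex.ofReal_re]
    simp
    linear_combination h
  · rw [Complex.ofReal_im]
    simp
    ring

/-- invariant power of the center, pair with incircle.
For the pair consisting of the ellipse with semi-axes `a, b` and the concentric
incircle of radius `r = ab/(a+b)`, every Poncelet 3-periodic has power of the origin
wrt the circumcircle equal to `−ab` and wrt the nine-point circle equal to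
`−ab·(a² + b²)/(2(a + b)²)`. -/
theorem power_center_incircle_pair
    (a b r : ℝ)
    (ha : 0 < a) (hb : 0 < b)
    (hr : r = a * b / (a + b))
    (E C_r : Set Pt)
    (hE : E = {P : Pt | (P 0) ^ 2 / a ^ 2 + (P 1) ^ 2 / b ^ 2 = 1})
    (hCr : C_r = {P : Pt | (P 0) ^ 2 + (P 1) ^ 2 = r ^ 2})
    (P₁ P₂ P₃ : Pt)
    (hP₁ : P₁ ∈ E) (hP₂ : P₂ ∈ E) (hP₃ : P₃ ∈ E)
    (hnd : AffineIndependent ℝ ![P₁, P₂, P₃])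
    (hcirc : Circumscribes P₁ P₂ P₃ C_r)
    (O : Pt) (R : ℝ)
    (hO₁ : dist O P₁ = R) (hO₂ : dist O P₂ = R) (hO₃ : dist O P₃ = R)
    (H : Pt)
    (hH₁ : ⟪H - P₁, P₂ - P₃⟫ = 0)
    (hH₂ : ⟪H - P₂, P₃ - P₁⟫ = 0)
    (hH₃ : ⟪H - P₃, P₁ - P₂⟫ = 0) :
    circlePower 0 O R = -(a * b) ∧
    circlePower 0 (midpoint ℝ O H) (R / 2) =
      -(a * b) * (a ^ 2 + b ^ 2) / (2 * (a + b) ^ 2) := by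
  have hab : 0 < a + b := add_pos ha hb
  have hrab : r * (a + b) = a * b := by rw [hr]; field_simp
  have hr0 : r ≠ 0 := by rw [hr]; positivity
  subst hE hCr
  simp only [Set.mem_ofPred_eq] at hP₁ hP₂ hP₃
  have hinj := hnd.injective
  have h₁₂ : P₁ ≠ P₂ := fun h => absurd (@hinj 0 1 h) (by decide)
  have h₂₃ : P₂ ≠ P₃ := fun h => absurd (@hinj 1 2 h) (by decide)
  have h₃₁ : P₃ ≠ P₁ := fun h => absurd (@hinj 2 0 h) (by decide)
  obtain ⟨t₃, t₁, t₂, -⟩ := hcirc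
  obtain ⟨c₁, s₁, n₁, l₁₂, l₁₃⟩ := exists_unit_normal_of_isTangentLine hr0 h₂₃ t₁
  obtain ⟨c₂, s₂, n₂, l₂₃, l₂₁⟩ := exists_unit_normal_of_isTangentLine hr0 h₃₁ t₂
  obtain ⟨c₃, s₃, n₃, l₃₁, l₃₂⟩ := exists_unit_normal_of_isTangentLine hr0 h₁₂ t₃
  have hdet := det_ne_zero_of_affineIndependent hnd
  have hdist : ∀ P : Pt, dist O P = R → (O 0 - P 0) ^ 2 + (O 1 - P 1) ^ 2 = R ^ 2 := by
    rintro P rfl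
    rw [EuclideanSpace.dist_sq_eq, Fin.sum_univ_two, Real.dist_eq, Real.dist_eq, sq_abs, sq_abs]
  have d₁ := hdist _ hO₁
  have d₂ := hdist _ hO₂
  have d₃ := hdist _ hO₃
  simp only [PiLp.inner_apply, Fin.sum_univ_two, PiLp.sub_apply, RCLike.inner_apply,
    conj_trivial] at hH₁ hH₂ hH₃
  obtain ⟨hq, hN⟩ := poncelet_power_relations
    (a := a) (b := b) (r := r) (u := ⟨c₁, s₁⟩) (v := ⟨c₂, s₂⟩) (w := ⟨c₃, s₃⟩)
    (by exact_mod_cast ha.ne') (by exact_mod_cast hb.ne') (by exact_mod_cast hab.ne')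
    (by exact_mod_cast hrab)
    (mk_ne_zero_of_unit n₁) (mk_ne_zero_of_unit n₂) (mk_ne_zero_of_unit n₃)
    (normals_ne_of_det_ne_zero (fun h => hdet (by linear_combination -h)) n₁ l₁₃ l₁₂ l₂₁)
    (normals_ne_of_det_ne_zero (fun h => hdet (by linear_combination -h)) n₂ l₂₁ l₂₃ l₃₂)
    (normals_ne_of_det_ne_zero (fun h => hdet (by linear_combination -h)) n₃ l₃₂ l₃₁ l₁₃)
    (conj_line_equation n₂ l₂₁) (conj_line_equation n₃ l₃₁)
    (conj_line_equation n₃ l₃₂) (conj_line_equation n₁ l₁₂)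
    (conj_line_equation n₁ l₁₃) (conj_line_equation n₂ l₂₃)
    (conj_ellipse_equation ha.ne' hb.ne' hP₂) (conj_ellipse_equation ha.ne' hb.ne' hP₃)
    (conj_circle_equation d₁) (conj_circle_equation d₂) (conj_circle_equation d₃)
  have hq' : R ^ 2 - O 0 ^ 2 - O 1 ^ 2 = a * b := by exact_mod_cast hq
  have hN' : ((P₁ 0 + P₂ 0 + P₃ 0 - O 0) ^ 2 + (P₁ 1 + P₂ 1 + P₃ 1 - O 1) ^ 2 - R ^ 2)
      * (a + b) ^ 2 = -2 * (a * b) * (a ^ 2 + b ^ 2) := by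
    rw [← Complex.ofReal_inj]
    push_cast
    rw [← hN]
    push_cast
    simp only [Complex.mk_eq_add_mul_I]
    push_cast
    linear_combination (a + b : ℂ) ^ 2 * ((P₁ 1 + P₂ 1 + P₃ 1 - O 1 : ℂ) ^ 2 - (O 1 : ℂ) ^ 2)
      * Complex.I_sq
  have hH0 : H 0 = P₁ 0 + P₂ 0 + P₃ 0 - 2 * O 0 := by
    apply mul_left_cancel₀ hdet
    linear_combination (P₃ 1 - P₁ 1) * (hH₁ - d₂ + d₃) - (P₂ 1 - P₃ 1) * (hH₂ - d₃ + d₁)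
  have hH1 : H 1 = P₁ 1 + P₂ 1 + P₃ 1 - 2 * O 1 := by
    apply mul_left_cancel₀ hdet
    linear_combination (P₂ 0 - P₃ 0) * (hH₂ - d₃ + d₁) - (P₃ 0 - P₁ 0) * (hH₁ - d₂ + d₃)
  constructor
  · rw [circlePower, EuclideanSpace.dist_sq_eq, Fin.sum_univ_two, Real.dist_eq, Real.dist_eq,
      sq_abs, sq_abs]
    simp only [PiLp.zero_apply]
    linear_combination -hq'
  · rw [circlePower, EuclideanSpace.dist_sq_eq, Fin.sum_univ_two, Real.dist_eq, Real.dist_eq,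
      sq_abs, sq_abs, midpoint_eq_smul_add]
    simp only [PiLp.zero_apply, PiLp.smul_apply, PiLp.add_apply, smul_eq_mul, hH0, hH1,
      invOf_eq_inv]
    rw [eq_div_iff (by positivity)]
    linear_combination hN' / 2
end
end

section
/- Let a > b > 0, c² = a² − b², δ = √(a⁴ − a²b² + b⁴), and let the confocal caustic have semi-axes a_c = a(δ − b²)/c² and b_c = b(a² − δ)/c². Let E = {(x,y) ∈ ℝ² : x²/a² + y²/b² = 1} and E_c = {(x,y) ∈ ℝ² : x²/a_c² + y²/b_c² = 1}. Set μ = a_c/a and η = b_c/b. Then for every triangle with vertices on E that circumscribes E_c (a billiard 3-periodic of the confocal pair), the power of the origin with respect to the nine-point circle equals δ·μ·η·(μ² + η² − 2)/(μ² + η² + 1). -/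
open scoped RealInnerProductSpace

noncomputable section

/-- A line tangent to the ellipse with semi-axes `p`, `q` satisfies the vanishing
discriminant condition. -/
lemma IsTangentLine.discriminant {p q : ℝ} (hp : p ≠ 0) (hq : q ≠ 0) {A B : Pt} (hAB : A ≠ B)
    (h : IsTangentLine (sideline A B) {P : Pt | (P 0) ^ 2 / p ^ 2 + (P 1) ^ 2 / q ^ 2 = 1}) :
    q ^ 2 * (B 0 - A 0) ^ 2 + p ^ 2 * (B 1 - A 1) ^ 2 = (A 0 * B 1 - A 1 * B 0) ^ 2 := by
  obtain ⟨Q, ⟨⟨t, rfl⟩, hQ⟩, huniq⟩ := h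
  have hd : B 0 - A 0 ≠ 0 ∨ B 1 - A 1 ≠ 0 := by
    by_contra! hcon
    refine hAB ?_
    ext i
    fin_cases i
    · simpa using (sub_eq_zero.mp hcon.1).symm
    · simpa using (sub_eq_zero.mp hcon.2).symm
  have hα : 0 < q ^ 2 * (B 0 - A 0) ^ 2 + p ^ 2 * (B 1 - A 1) ^ 2 := by
    rcases hd with hd | hd <;> positivity
  set α := q ^ 2 * (B 0 - A 0) ^ 2 + p ^ 2 * (B 1 - A 1) ^ 2 with hαdef
  set β := q ^ 2 * A 0 * (B 0 - A 0) + p ^ 2 * A 1 * (B 1 - A 1) with hβdef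
  have mem_iff (s : ℝ) : A + s • (B - A) ∈
      {P : Pt | (P 0) ^ 2 / p ^ 2 + (P 1) ^ 2 / q ^ 2 = 1} ↔
      α * s ^ 2 + 2 * β * s + (q ^ 2 * A 0 ^ 2 + p ^ 2 * A 1 ^ 2 - p ^ 2 * q ^ 2) = 0 := by
    simp only [Set.mem_ofPred_eq, PiLp.add_apply, PiLp.smul_apply, PiLp.sub_apply, smul_eq_mul]
    rw [div_add_div _ _ (by positivity) (by positivity), div_eq_one_iff_eq (by positivity)]
    constructor <;> intro h <;> rw [hαdef, hβdef] at * <;> linear_combination h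
  have ht := (mem_iff t).1 hQ
  have hs : A + (-2 * β / α - t) • (B - A) ∈
      {P : Pt | (P 0) ^ 2 / p ^ 2 + (P 1) ^ 2 / q ^ 2 = 1} := by
    rw [mem_iff, ← ht]
    field_simp
    ring
  have heq := huniq _ ⟨⟨_, rfl⟩, hs⟩
  have hts : -2 * β / α - t = t := by
    have := add_left_cancel heq
    exact smul_left_injective ℝ (sub_ne_zero.mpr hAB.symm) this
  have hβ : β = -(α * t) := by
    field_simp at hts
    linarith
  have hdisc : p ^ 2 * q ^ 2 * (α - (A 0 * B 1 - A 1 * B 0) ^ 2) = 0 := by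
    have h1 : β ^ 2 - α * (q ^ 2 * A 0 ^ 2 + p ^ 2 * A 1 ^ 2 - p ^ 2 * q ^ 2) = 0 := by
      linear_combination (β + α * t) * hβ - α * ht
    rw [hαdef, hβdef] at h1
    rw [hαdef]
    linear_combination h1
  have := (mul_eq_zero.mp hdisc).resolve_left (by positivity)
  linarith

/-- The complex form of the tangency condition for a chord of the unit circle. -/
lemma chord_tangency_complex {μ η u₁ v₁ u₂ v₂ : ℝ}
    (h₁ : u₁ ^ 2 + v₁ ^ 2 = 1) (h₂ : u₂ ^ 2 + v₂ ^ 2 = 1)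
    (hne : (⟨u₁, v₁⟩ : ℂ) ≠ ⟨u₂, v₂⟩)
    (h : η ^ 2 * (u₂ - u₁) ^ 2 + μ ^ 2 * (v₂ - v₁) ^ 2 = (u₁ * v₂ - v₁ * u₂) ^ 2) :
    ((⟨u₁, v₁⟩ : ℂ) + ⟨u₂, v₂⟩) ^ 2 =
      μ ^ 2 * (1 + (⟨u₁, v₁⟩ : ℂ) * ⟨u₂, v₂⟩) ^ 2 -
        η ^ 2 * (1 - (⟨u₁, v₁⟩ : ℂ) * ⟨u₂, v₂⟩) ^ 2 := by
  have H₁ : (u₁ : ℂ) ^ 2 + v₁ ^ 2 = 1 := mod_cast h₁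
  have H₂ : (u₂ : ℂ) ^ 2 + v₂ ^ 2 = 1 := mod_cast h₂
  have H : (η : ℂ) ^ 2 * (u₂ - u₁) ^ 2 + μ ^ 2 * (v₂ - v₁) ^ 2 = (u₁ * v₂ - v₁ * u₂) ^ 2 :=
    mod_cast h
  have e₁ : (⟨u₁, v₁⟩ : ℂ) = u₁ + v₁ * Complex.I := Complex.mk_eq_add_mul_I _ _
  have e₂ : (⟨u₂, v₂⟩ : ℂ) = u₂ + v₂ * Complex.I := Complex.mk_eq_add_mul_I _ _
  set z := (⟨u₁, v₁⟩ : ℂ)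
  set w := (⟨u₂, v₂⟩ : ℂ)
  have hI := Complex.I_sq
  obtain ⟨z', hz', hzz⟩ : ∃ z' : ℂ, z' = u₁ - v₁ * Complex.I ∧ z * z' = 1 :=
    ⟨_, rfl, by rw [e₁]; linear_combination H₁ - v₁ ^ 2 * hI⟩
  obtain ⟨w', hw', hww⟩ : ∃ w' : ℂ, w' = u₂ - v₂ * Complex.I ∧ w * w' = 1 :=
    ⟨_, rfl, by rw [e₂]; linear_combination H₂ - v₂ ^ 2 * hI⟩
  have hz0 : z ≠ 0 := left_ne_zero_of_mul_eq_one hzz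
  have hw0 : w ≠ 0 := left_ne_zero_of_mul_eq_one hww
  have hu₁ : (u₁ : ℂ) = (z + z') / 2 := by rw [e₁, hz']; ring
  have hu₂ : (u₂ : ℂ) = (w + w') / 2 := by rw [e₂, hw']; ring
  have hv₁ : (v₁ : ℂ) = -(z - z') / 2 * Complex.I := by
    rw [e₁, hz']; linear_combination v₁ * hI
  have hv₂ : (v₂ : ℂ) = -(w - w') / 2 * Complex.I := by
    rw [e₂, hw']; linear_combination v₂ * hI
  rw [hu₁, hu₂, hv₁, hv₂, eq_inv_of_mul_eq_one_right hzz, eq_inv_of_mul_eq_one_right hww] at H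
  have hfac : (z - w) ^ 2 * ((z + w) ^ 2 -
      (μ ^ 2 * (1 + z * w) ^ 2 - η ^ 2 * (1 - z * w) ^ 2)) = 0 := by
    field_simp at H
    simp only [hI] at H
    linear_combination (1 / 4) * H
  have := (mul_eq_zero.mp hfac).resolve_left (pow_ne_zero _ (sub_ne_zero.mpr hne))
  linear_combination this

/-- The Poncelet closure relation: `1 - m * z₁ ^ 2` is the leading coefficient of the quadratic
whose roots are the other two vertices. -/
lemma poncelet_esymm_two {m z₁ z₂ z₃ : ℂ} (hne : z₂ ≠ z₃) (hlead : 1 - m * z₁ ^ 2 ≠ 0)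
    (h₂ : (z₁ + z₂) ^ 2 =
      ((1 + m) / 2) ^ 2 * (1 + z₁ * z₂) ^ 2 - ((1 - m) / 2) ^ 2 * (1 - z₁ * z₂) ^ 2)
    (h₃ : (z₁ + z₃) ^ 2 =
      ((1 + m) / 2) ^ 2 * (1 + z₁ * z₃) ^ 2 - ((1 - m) / 2) ^ 2 * (1 - z₁ * z₃) ^ 2) :
    z₁ * z₂ + z₁ * z₃ + z₂ * z₃ = -m := by
  have hsum : (z₂ + z₃) * (1 - m * z₁ ^ 2) + (1 - m ^ 2) * z₁ = 0 := by
    apply mul_left_cancel₀ (sub_ne_zero.mpr hne)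
    linear_combination h₂ - h₃
  have hprod : z₂ * z₃ * (1 - m * z₁ ^ 2) - (z₁ ^ 2 - m) = 0 := by
    linear_combination z₂ * hsum - h₂
  have : (1 - m * z₁ ^ 2) * (z₁ * z₂ + z₁ * z₃ + z₂ * z₃ + m) = 0 := by
    linear_combination z₁ * hsum + hprod
  linear_combination (mul_eq_zero.mp this).resolve_left hlead

/-- A palindromic-ended quartic vanishing at three distinct points. -/
lemma quartic_middle_coeff {k β γ β' z₁ z₂ z₃ : ℂ} (h12 : z₁ ≠ z₂) (h13 : z₁ ≠ z₃) (h23 : z₂ ≠ z₃)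
    (h₁ : k * z₁ ^ 4 - β * z₁ ^ 3 + γ * z₁ ^ 2 - β' * z₁ + k = 0)
    (h₂ : k * z₂ ^ 4 - β * z₂ ^ 3 + γ * z₂ ^ 2 - β' * z₂ + k = 0)
    (h₃ : k * z₃ ^ 4 - β * z₃ ^ 3 + γ * z₃ ^ 2 - β' * z₃ + k = 0) :
    γ * (z₁ * z₂ * z₃) =
      k * (z₁ + z₂ + z₃) + k * (z₁ * z₂ + z₁ * z₃ + z₂ * z₃) * (z₁ * z₂ * z₃) := by
  have d12 : k * (z₁ ^ 3 + z₁ ^ 2 * z₂ + z₁ * z₂ ^ 2 + z₂ ^ 3) - β * (z₁ ^ 2 + z₁ * z₂ + z₂ ^ 2)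
      + γ * (z₁ + z₂) - β' = 0 := by
    apply mul_left_cancel₀ (sub_ne_zero.mpr h12)
    linear_combination h₁ - h₂
  have d13 : k * (z₁ ^ 3 + z₁ ^ 2 * z₃ + z₁ * z₃ ^ 2 + z₃ ^ 3) - β * (z₁ ^ 2 + z₁ * z₃ + z₃ ^ 2)
      + γ * (z₁ + z₃) - β' = 0 := by
    apply mul_left_cancel₀ (sub_ne_zero.mpr h13)
    linear_combination h₁ - h₃
  have d123 : k * ((z₁ + z₂ + z₃) ^ 2 - (z₁ * z₂ + z₁ * z₃ + z₂ * z₃)) - β * (z₁ + z₂ + z₃)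
      + γ = 0 := by
    apply mul_left_cancel₀ (sub_ne_zero.mpr h23)
    linear_combination d12 - d13
  have hl : (β - k * (z₁ + z₂ + z₃)) * (z₁ * z₂ * z₃) = k := by
    linear_combination -h₁ + z₁ * d12 - z₁ * z₂ * d123
  linear_combination (z₁ * z₂ * z₃) * d123 + (z₁ + z₂ + z₃) * hl

/-- The three vertices of an affinely independent triangle have nonzero signed area. -/
lemma AffineIndependent.area_ne_zero {P₁ P₂ P₃ : Pt} (h : AffineIndependent ℝ ![P₁, P₂, P₃]) :
    (P₂ 0 - P₁ 0) * (P₃ 1 - P₁ 1) - (P₃ 0 - P₁ 0) * (P₂ 1 - P₁ 1) ≠ 0 := by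
  intro hdet
  have h12 : P₁ ≠ P₂ := fun h' => absurd (h.injective (a₁ := 0) (a₂ := 1) h') (by decide)
  have hcol : Collinear ℝ {P₁, P₂, P₃} := by
    rw [collinear_iff_of_mem (p₀ := P₁) (by simp)]
    refine ⟨P₂ - P₁, ?_⟩
    have hd : P₂ 0 - P₁ 0 ≠ 0 ∨ P₂ 1 - P₁ 1 ≠ 0 := by
      by_contra! hcon
      refine h12 ?_
      ext i
      fin_cases i
      · simpa using (sub_eq_zero.mp hcon.1).symm
      · simpa using (sub_eq_zero.mp hcon.2).symm
    rintro p (rfl | rfl | rfl)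
    · exact ⟨0, by simp⟩
    · exact ⟨1, by simp⟩
    · rcases hd with hd | hd
      · refine ⟨(p 0 - P₁ 0) / (P₂ 0 - P₁ 0), ?_⟩
        ext i
        fin_cases i <;> simp <;> field_simp
        · ring
        · linear_combination hdet
      · refine ⟨(p 1 - P₁ 1) / (P₂ 1 - P₁ 1), ?_⟩
        ext i
        fin_cases i <;> simp <;> field_simp
        · linear_combination -hdet
        · ring
  exact affineIndependent_iff_not_collinear_set.mp h hcol


/-- For a Poncelet triangle `z₁ z₂ z₃` in the unit circle, `e₁ = -m * e₃`. -/
lemma esymm_one_of_esymm_two {m : ℝ} {z₁ z₂ z₃ : ℂ}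
    (h₁ : z₁ * (starRingEnd ℂ) z₁ = 1) (h₂ : z₂ * (starRingEnd ℂ) z₂ = 1)
    (h₃ : z₃ * (starRingEnd ℂ) z₃ = 1) (h : z₁ * z₂ + z₁ * z₃ + z₂ * z₃ = -m) :
    z₁ + z₂ + z₃ = -m * (z₁ * z₂ * z₃) := by
  have hc := congrArg (starRingEnd ℂ) h
  simp only [map_add, map_mul, map_neg, Complex.conj_ofReal] at hc
  set w₁ := (starRingEnd ℂ) z₁
  set w₂ := (starRingEnd ℂ) z₂
  set w₃ := (starRingEnd ℂ) z₃
  linear_combination (z₁ * z₂ * z₃) * hc - z₃ * z₂ * w₂ * h₁ - z₃ * h₂ - z₂ * z₃ * w₃ * h₁ - z₂ * h₃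
    - z₁ * z₃ * w₃ * h₂ - z₁ * h₃

/-- The complex form of the equation of a circle meeting an ellipse. -/
lemma circle_ellipse_quartic {a b X Y w u v : ℝ} (h : u ^ 2 + v ^ 2 = 1)
    (hw : a ^ 2 * u ^ 2 + b ^ 2 * v ^ 2 - 2 * X * u - 2 * Y * v + w = 0) :
    ((a : ℂ) ^ 2 - b ^ 2) / 4 * (⟨u, v⟩ : ℂ) ^ 4 - (X - Y * Complex.I) * (⟨u, v⟩ : ℂ) ^ 3 +
      ((a ^ 2 + b ^ 2) / 2 + w) * (⟨u, v⟩ : ℂ) ^ 2 - (X + Y * Complex.I) * (⟨u, v⟩ : ℂ) +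
      ((a : ℂ) ^ 2 - b ^ 2) / 4 = 0 := by
  have H : (u : ℂ) ^ 2 + v ^ 2 = 1 := mod_cast h
  have W : (a : ℂ) ^ 2 * u ^ 2 + b ^ 2 * v ^ 2 - 2 * X * u - 2 * Y * v + w = 0 := mod_cast hw
  have e : (⟨u, v⟩ : ℂ) = u + v * Complex.I := Complex.mk_eq_add_mul_I _ _
  set z := (⟨u, v⟩ : ℂ)
  have hI := Complex.I_sq
  obtain ⟨z', hz', hzz⟩ : ∃ z' : ℂ, z' = u - v * Complex.I ∧ z * z' = 1 :=
    ⟨_, rfl, by rw [e]; linear_combination H - v ^ 2 * hI⟩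
  have hz0 : z ≠ 0 := left_ne_zero_of_mul_eq_one hzz
  have hu : (u : ℂ) = (z + z') / 2 := by rw [e, hz']; ring
  have hv : (v : ℂ) = -(z - z') / 2 * Complex.I := by
    rw [e, hz']; linear_combination v * hI
  rw [hu, hv, eq_inv_of_mul_eq_one_right hzz] at W
  field_simp at W
  simp only [hI] at W
  linear_combination (1 / 4) * W

/-- Symmetric functions and circumcircle power of the center for a Poncelet triangle, in
coordinates for which the outer ellipse is the unit circle. -/
lemma poncelet_unit_circle {a b μ η u₁ v₁ u₂ v₂ u₃ v₃ X Y w : ℝ}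
    (hμ : 0 < μ) (hη : 0 < η) (hμη : μ + η = 1)
    (h₁ : u₁ ^ 2 + v₁ ^ 2 = 1) (h₂ : u₂ ^ 2 + v₂ ^ 2 = 1) (h₃ : u₃ ^ 2 + v₃ ^ 2 = 1)
    (h12 : (⟨u₁, v₁⟩ : ℂ) ≠ ⟨u₂, v₂⟩) (h13 : (⟨u₁, v₁⟩ : ℂ) ≠ ⟨u₃, v₃⟩)
    (h23 : (⟨u₂, v₂⟩ : ℂ) ≠ ⟨u₃, v₃⟩)
    (t12 : η ^ 2 * (u₂ - u₁) ^ 2 + μ ^ 2 * (v₂ - v₁) ^ 2 = (u₁ * v₂ - v₁ * u₂) ^ 2)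
    (t13 : η ^ 2 * (u₃ - u₁) ^ 2 + μ ^ 2 * (v₃ - v₁) ^ 2 = (u₁ * v₃ - v₁ * u₃) ^ 2)
    (w₁ : a ^ 2 * u₁ ^ 2 + b ^ 2 * v₁ ^ 2 - 2 * X * u₁ - 2 * Y * v₁ + w = 0)
    (w₂ : a ^ 2 * u₂ ^ 2 + b ^ 2 * v₂ ^ 2 - 2 * X * u₂ - 2 * Y * v₂ + w = 0)
    (w₃ : a ^ 2 * u₃ ^ 2 + b ^ 2 * v₃ ^ 2 - 2 * X * u₃ - 2 * Y * v₃ + w = 0) :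
    u₁ * u₂ + u₁ * u₃ + u₂ * u₃ - (v₁ * v₂ + v₁ * v₃ + v₂ * v₃) = -(μ - η) ∧
    (u₁ + u₂ + u₃) ^ 2 + (v₁ + v₂ + v₃) ^ 2 = (μ - η) ^ 2 ∧
    (a ^ 2 + b ^ 2) / 2 + w = -(μ - η) * (a ^ 2 - b ^ 2) / 2 := by
  have q₁ := circle_ellipse_quartic h₁ w₁
  have q₂ := circle_ellipse_quartic h₂ w₂
  have q₃ := circle_ellipse_quartic h₃ w₃
  have c12 := chord_tangency_complex h₁ h₂ h12 t12
  have c13 := chord_tangency_complex h₁ h₃ h13 t13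
  have unit_conj {u v : ℝ} (h : u ^ 2 + v ^ 2 = 1) :
      (⟨u, v⟩ : ℂ) * (starRingEnd ℂ) ⟨u, v⟩ = 1 := by
    rw [Complex.mul_conj, Complex.normSq_mk]
    norm_cast
    linarith
  have n₁ := unit_conj h₁
  have n₂ := unit_conj h₂
  have n₃ := unit_conj h₃
  have hre : ((⟨u₁, v₁⟩ : ℂ) * ⟨u₂, v₂⟩ + (⟨u₁, v₁⟩ : ℂ) * ⟨u₃, v₃⟩ +
      (⟨u₂, v₂⟩ : ℂ) * ⟨u₃, v₃⟩).re =
      u₁ * u₂ + u₁ * u₃ + u₂ * u₃ - (v₁ * v₂ + v₁ * v₃ + v₂ * v₃) := by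
    simp
    ring
  have hnorm : Complex.normSq ((⟨u₁, v₁⟩ : ℂ) + ⟨u₂, v₂⟩ + ⟨u₃, v₃⟩) =
      (u₁ + u₂ + u₃) ^ 2 + (v₁ + v₂ + v₃) ^ 2 := by
    simp [Complex.normSq_apply]
    ring
  set z₁ := (⟨u₁, v₁⟩ : ℂ)
  set z₂ := (⟨u₂, v₂⟩ : ℂ)
  set z₃ := (⟨u₃, v₃⟩ : ℂ)
  have hsq {z : ℂ} (h : z * (starRingEnd ℂ) z = 1) : Complex.normSq z = 1 := by
    rw [Complex.mul_conj] at h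
    exact_mod_cast h
  have hμ' : (μ : ℂ) = (1 + (μ - η : ℝ)) / 2 := by
    rw [← Complex.ofReal_one, ← hμη]; push_cast; ring
  have hη' : (η : ℂ) = (1 - (μ - η : ℝ)) / 2 := by
    rw [← Complex.ofReal_one, ← hμη]; push_cast; ring
  set m := μ - η with hm
  rw [hμ', hη'] at c12 c13
  have hlead : 1 - (m : ℂ) * z₁ ^ 2 ≠ 0 := by
    intro h0
    have h1 := congrArg Complex.normSq (sub_eq_zero.mp h0)
    simp only [map_one, map_mul, map_pow, hsq n₁, Complex.normSq_ofReal, one_pow, mul_one] at h1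
    nlinarith
  have e₂ := poncelet_esymm_two h23 hlead c12 c13
  have e₁ := esymm_one_of_esymm_two n₁ n₂ n₃ e₂
  refine ⟨?_, ?_, ?_⟩
  · rw [← hre, e₂]
    simp
  · rw [← hnorm, e₁]
    simp only [map_mul, Complex.normSq_neg, Complex.normSq_ofReal, hsq n₁, hsq n₂, hsq n₃]
    ring
  · have hq := quartic_middle_coeff h12 h13 h23 q₁ q₂ q₃
    rw [e₁, e₂] at hq
    have h0 : z₁ * z₂ * z₃ ≠ 0 :=
      mul_ne_zero (mul_ne_zero (left_ne_zero_of_mul_eq_one n₁) (left_ne_zero_of_mul_eq_one n₂))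
        (left_ne_zero_of_mul_eq_one n₃)
    have hγ : ((a : ℂ) ^ 2 + b ^ 2) / 2 + w = -m * (a ^ 2 - b ^ 2) / 2 := by
      apply mul_right_cancel₀ h0
      linear_combination hq
    exact_mod_cast hγ

lemma dist_sq_eq_coord (P Q : Pt) : dist P Q ^ 2 = (P 0 - Q 0) ^ 2 + (P 1 - Q 1) ^ 2 := by
  rw [EuclideanSpace.dist_eq, Real.sq_sqrt (Finset.sum_nonneg fun _ _ => sq_nonneg _)]
  simp [Fin.sum_univ_two, Real.dist_eq, sq_abs]

lemma inner_eq_coord (P Q : Pt) : ⟪P, Q⟫ = P 0 * Q 0 + P 1 * Q 1 := by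
  simp [PiLp.inner_apply, Fin.sum_univ_two, mul_comm]

/-- Sylvester's relation `H = P₁ + P₂ + P₃ - 2 O` between orthocenter and circumcenter. -/
lemma orthocenter_coord {P₁ P₂ P₃ O H : Pt} {R : ℝ} (hnd : AffineIndependent ℝ ![P₁, P₂, P₃])
    (hO₁ : dist O P₁ = R) (hO₂ : dist O P₂ = R) (hO₃ : dist O P₃ = R)
    (hH₂ : ⟪H - P₂, P₃ - P₁⟫ = 0) (hH₃ : ⟪H - P₃, P₁ - P₂⟫ = 0) :
    H 0 = P₁ 0 + P₂ 0 + P₃ 0 - 2 * O 0 ∧ H 1 = P₁ 1 + P₂ 1 + P₃ 1 - 2 * O 1 := by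
  have harea := hnd.area_ne_zero
  have d₁ := dist_sq_eq_coord O P₁
  have d₂ := dist_sq_eq_coord O P₂
  have d₃ := dist_sq_eq_coord O P₃
  rw [hO₁] at d₁
  rw [hO₂] at d₂
  rw [hO₃] at d₃
  simp only [inner_eq_coord, PiLp.sub_apply] at hH₂ hH₃
  have k₂ : (H 0 - (P₁ 0 + P₂ 0 + P₃ 0 - 2 * O 0)) * (P₃ 0 - P₁ 0) +
      (H 1 - (P₁ 1 + P₂ 1 + P₃ 1 - 2 * O 1)) * (P₃ 1 - P₁ 1) = 0 := by
    linear_combination hH₂ + d₃ - d₁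
  have k₃ : (H 0 - (P₁ 0 + P₂ 0 + P₃ 0 - 2 * O 0)) * (P₂ 0 - P₁ 0) +
      (H 1 - (P₁ 1 + P₂ 1 + P₃ 1 - 2 * O 1)) * (P₂ 1 - P₁ 1) = 0 := by
    linear_combination -hH₃ + d₂ - d₁
  constructor
  · apply sub_eq_zero.mp
    apply (mul_eq_zero.mp ?_).resolve_left harea
    linear_combination (P₃ 1 - P₁ 1) * k₃ - (P₂ 1 - P₁ 1) * k₂
  · apply sub_eq_zero.mp
    apply (mul_eq_zero.mp ?_).resolve_left harea
    linear_combination (P₂ 0 - P₁ 0) * k₂ - (P₃ 0 - P₁ 0) * k₃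

/-- The power of the origin with respect to the nine-point circle. -/
lemma circlePower_ninepoint {P₁ P₂ P₃ O H : Pt} {R : ℝ}
    (hnd : AffineIndependent ℝ ![P₁, P₂, P₃])
    (hO₁ : dist O P₁ = R) (hO₂ : dist O P₂ = R) (hO₃ : dist O P₃ = R)
    (hH₂ : ⟪H - P₂, P₃ - P₁⟫ = 0) (hH₃ : ⟪H - P₃, P₁ - P₂⟫ = 0) :
    2 * circlePower 0 (midpoint ℝ O H) (R / 2) =
      P₁ 0 * P₂ 0 + P₁ 0 * P₃ 0 + P₂ 0 * P₃ 0 + (P₁ 1 * P₂ 1 + P₁ 1 * P₃ 1 + P₂ 1 * P₃ 1) -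
        (O 0 ^ 2 + O 1 ^ 2 - R ^ 2) := by
  obtain ⟨hH0, hH1⟩ := orthocenter_coord hnd hO₁ hO₂ hO₃ hH₂ hH₃
  have d₁ := dist_sq_eq_coord O P₁
  have d₂ := dist_sq_eq_coord O P₂
  have d₃ := dist_sq_eq_coord O P₃
  rw [hO₁] at d₁
  rw [hO₂] at d₂
  rw [hO₃] at d₃
  simp only [circlePower, dist_sq_eq_coord, midpoint_eq_smul_add, PiLp.zero_apply,
    PiLp.smul_apply, PiLp.add_apply, smul_eq_mul, hH0, hH1, invOf_eq_inv]
  linear_combination -(1 / 2) * (d₁ + d₂ + d₃)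

/-- invariant power of the center, confocal pair, nine-point circle.
For the confocal pair (elliptic billiard) with `δ = √(a⁴ − a²b² + b⁴)`,
`a_c = a(δ − b²)/c²`, `b_c = b(a² − δ)/c²`, `μ = a_c/a`, `η = b_c/b`, every billiard
3-periodic has power of the origin wrt the nine-point circle equal to
`δ·μ·η·(μ² + η² − 2)/(μ² + η² + 1)`. -/
theorem power_center_confocal_ninepoint
    (a b c δ a_c b_c μ η : ℝ)
    (hab : a > b) (hb : 0 < b)
    (hc : c ^ 2 = a ^ 2 - b ^ 2)
    (hδ : δ = Real.sqrt (a ^ 4 - a ^ 2 * b ^ 2 + b ^ 4))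
    (hac : a_c = a * (δ - b ^ 2) / c ^ 2)
    (hbc : b_c = b * (a ^ 2 - δ) / c ^ 2)
    (hμ : μ = a_c / a) (hη : η = b_c / b)
    (E E_c : Set Pt)
    (hE : E = {P : Pt | (P 0) ^ 2 / a ^ 2 + (P 1) ^ 2 / b ^ 2 = 1})
    (hEc : E_c = {P : Pt | (P 0) ^ 2 / a_c ^ 2 + (P 1) ^ 2 / b_c ^ 2 = 1})
    (P₁ P₂ P₃ : Pt)
    (hP₁ : P₁ ∈ E) (hP₂ : P₂ ∈ E) (hP₃ : P₃ ∈ E)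
    (hnd : AffineIndependent ℝ ![P₁, P₂, P₃])
    (hcirc : Circumscribes P₁ P₂ P₃ E_c)
    (O : Pt) (R : ℝ)
    (hO₁ : dist O P₁ = R) (hO₂ : dist O P₂ = R) (hO₃ : dist O P₃ = R)
    (H : Pt)
    (hH₁ : ⟪H - P₁, P₂ - P₃⟫ = 0)
    (hH₂ : ⟪H - P₂, P₃ - P₁⟫ = 0)
    (hH₃ : ⟪H - P₃, P₁ - P₂⟫ = 0) :
    circlePower 0 (midpoint ℝ O H) (R / 2) =
      δ * μ * η * (μ ^ 2 + η ^ 2 - 2) / (μ ^ 2 + η ^ 2 + 1) := by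
  have ha : 0 < a := hb.trans hab
  have hAB : b ^ 2 < a ^ 2 := by gcongr
  have hC : 0 < c ^ 2 := by rw [hc]; linarith
  have hC0 : c ^ 2 ≠ 0 := hC.ne'
  have hB : 0 < b ^ 2 := by positivity
  have hδ2 : δ ^ 2 = a ^ 4 - a ^ 2 * b ^ 2 + b ^ 4 := by
    rw [hδ, Real.sq_sqrt]
    nlinarith
  have hδ0 : 0 ≤ δ := hδ ▸ Real.sqrt_nonneg _
  have hbδ : b ^ 2 < δ := by
    apply lt_of_pow_lt_pow_left₀ 2 hδ0
    nlinarith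
  have hδa : δ < a ^ 2 := by
    apply lt_of_pow_lt_pow_left₀ 2 (by positivity)
    nlinarith
  have hμ' : μ = (δ - b ^ 2) / c ^ 2 := by rw [hμ, hac]; field_simp
  have hη' : η = (a ^ 2 - δ) / c ^ 2 := by rw [hη, hbc]; field_simp
  have hμ0 : 0 < μ := hμ' ▸ div_pos (by linarith) hC
  have hη0 : 0 < η := hη' ▸ div_pos (by linarith) hC
  have hμc : μ * c ^ 2 = δ - b ^ 2 := by rw [hμ', div_mul_cancel₀ _ hC0]
  have hηc : η * c ^ 2 = a ^ 2 - δ := by rw [hη', div_mul_cancel₀ _ hC0]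
  have hμη : μ + η = 1 := by
    apply mul_right_cancel₀ hC0
    linear_combination hμc + hηc - hc
  have hac' : a_c = a * μ := by rw [hμ]; field_simp
  have hbc' : b_c = b * η := by rw [hη]; field_simp
  have h12 : P₁ ≠ P₂ := fun h' => absurd (hnd.injective (a₁ := 0) (a₂ := 1) h') (by decide)
  have h13 : P₁ ≠ P₃ := fun h' => absurd (hnd.injective (a₁ := 0) (a₂ := 2) h') (by decide)
  have h23 : P₂ ≠ P₃ := fun h' => absurd (hnd.injective (a₁ := 1) (a₂ := 2) h') (by decide)
  have hac0 : a_c ≠ 0 := by rw [hac']; positivity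
  have hbc0 : b_c ≠ 0 := by rw [hbc']; positivity
  obtain ⟨T12, -, T31, -⟩ := hcirc
  rw [hEc] at T12 T31
  have D12 := T12.discriminant hac0 hbc0 h12
  have D31 := T31.discriminant hac0 hbc0 h13.symm
  have d₁ := dist_sq_eq_coord O P₁
  have d₂ := dist_sq_eq_coord O P₂
  have d₃ := dist_sq_eq_coord O P₃
  rw [hO₁] at d₁
  rw [hO₂] at d₂
  rw [hO₃] at d₃
  have hpow := circlePower_ninepoint hnd hO₁ hO₂ hO₃ hH₂ hH₃
  have scale (P : Pt) (hP : P ∈ E) :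
      ∃ u v : ℝ, P 0 = a * u ∧ P 1 = b * v ∧ u ^ 2 + v ^ 2 = 1 := by
    refine ⟨P 0 / a, P 1 / b, by field_simp, by field_simp, ?_⟩
    rw [hE] at hP
    simpa only [div_pow, Set.mem_ofPred_eq] using hP
  obtain ⟨u₁, v₁, x₁, y₁, n₁⟩ := scale P₁ hP₁
  obtain ⟨u₂, v₂, x₂, y₂, n₂⟩ := scale P₂ hP₂
  obtain ⟨u₃, v₃, x₃, y₃, n₃⟩ := scale P₃ hP₃
  have mk_ne {P Q : Pt} {u v u' v' : ℝ} (h : P ≠ Q) (hx : P 0 = a * u) (hy : P 1 = b * v)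
      (hx' : Q 0 = a * u') (hy' : Q 1 = b * v') : (⟨u, v⟩ : ℂ) ≠ ⟨u', v'⟩ := by
    intro heq
    obtain ⟨hu, hv⟩ := Complex.mk.inj heq
    apply h
    ext i
    fin_cases i
    · simp [hx, hx', hu]
    · simp [hy, hy', hv]
  rw [x₁, x₂, y₁, y₂, hac', hbc'] at D12
  rw [x₁, x₃, y₁, y₃, hac', hbc'] at D31
  rw [x₁, y₁] at d₁
  rw [x₂, y₂] at d₂
  rw [x₃, y₃] at d₃
  rw [x₁, y₁, x₂, y₂, x₃, y₃] at hpow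
  have hab0 : (a * b) ^ 2 ≠ 0 := by positivity
  obtain ⟨s₂, s₁, hw⟩ := poncelet_unit_circle (a := a) (b := b) (X := a * O 0) (Y := b * O 1)
    (w := O 0 ^ 2 + O 1 ^ 2 - R ^ 2) hμ0 hη0 hμη n₁ n₂ n₃
    (mk_ne h12 x₁ y₁ x₂ y₂) (mk_ne h13 x₁ y₁ x₃ y₃) (mk_ne h23 x₂ y₂ x₃ y₃)
    (mul_left_cancel₀ hab0 (by linear_combination D12))
    (mul_left_cancel₀ hab0 (by linear_combination D31))
    (by linear_combination -d₁) (by linear_combination -d₂) (by linear_combination -d₃)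
  have hη1 : η = 1 - μ := by linarith
  have hδμ : δ = a ^ 2 * μ + b ^ 2 * η := by
    rw [hη1]
    linear_combination -hμc + μ * hc
  have hval : 2 * circlePower 0 (midpoint ℝ O H) (R / 2) = -(μ * η) * (a ^ 2 + b ^ 2) := by
    have hu : u₁ * u₂ + u₁ * u₃ + u₂ * u₃ = ((μ - η) ^ 2 - 3 - 2 * (μ - η)) / 4 := by
      linear_combination (1 / 2) * s₂ + (1 / 4) * s₁ - (1 / 4) * (n₁ + n₂ + n₃)
    have hv : v₁ * v₂ + v₁ * v₃ + v₂ * v₃ = ((μ - η) ^ 2 - 3 + 2 * (μ - η)) / 4 := by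
      linear_combination -(1 / 2) * s₂ + (1 / 4) * s₁ - (1 / 4) * (n₁ + n₂ + n₃)
    rw [hpow]
    rw [hη1] at hu hv hw ⊢
    linear_combination a ^ 2 * hu + b ^ 2 * hv - hw
  have hkey : (a ^ 2 + b ^ 2) * (1 - μ * η) = δ * (1 + 2 * (μ * η)) := by
    have hp : μ * η * (c ^ 2) ^ 2 = δ * (a ^ 2 + b ^ 2) - a ^ 4 - b ^ 4 := by
      linear_combination η * c ^ 2 * hμc + (δ - b ^ 2) * hηc - hδ2
    apply mul_right_cancel₀ (pow_ne_zero 2 hC0)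
    linear_combination (-(a ^ 2 + b ^ 2) - 2 * δ) * hp
      + (a ^ 2 + b ^ 2 - δ) * (c ^ 2 + a ^ 2 - b ^ 2) * hc - 2 * (a ^ 2 + b ^ 2) * hδ2
  rw [eq_div_iff (by positivity)]
  rw [hη1] at hval hkey ⊢
  linear_combination (1 / 2) * (μ ^ 2 + (1 - μ) ^ 2 + 1) * hval - μ * (1 - μ) * hkey
end
end
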